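/- For every k >= 0 and every 1 <= n <= 2^k, the even interval at level k+2 satisfies I_{k+2}^(2n) = 3 / ((d_k^(n) + 2*d_k^(n+1)) * (2*d_k^(n) + d_k^(n+1))). -/

import Mathlib

/-- Numerators of the modified Farey sequence: at level `k`, order `n` (1-indexed,
`n = 1, …, 2^k + 1`). Level 0 is `0/1, 1/1`; odd orders at level `k+1` are carried
over from level `k`, even orders are mediants. -/
def fareyNum : ℕ → ℕ → ℕ
  | 0, n => if n = 1 then 0 else 1
  | k + 1, m =>
      if m % 2 = 1 then fareyNum k ((m + 1) / 2)
      else fareyNum k (m / 2) + fareyNum k (m / 2 + 1)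

/-- Denominators of the modified Farey sequence. -/
def fareyDen : ℕ → ℕ → ℕ
  | 0, _ => 1
  | k + 1, m =>
      if m % 2 = 1 then fareyDen k ((m + 1) / 2)
      else fareyDen k (m / 2) + fareyDen k (m / 2 + 1)

/-- The Farey fraction `r_k^(n) = n_k^(n) / d_k^(n)` as a real number. -/
noncomputable def fareyR (k n : ℕ) : ℝ := (fareyNum k n : ℝ) / (fareyDen k n : ℝ)

/-- The interval `I_k^(n)`: for `n ≥ 2` it is `r_k^(2n) - r_k^(2n-2)`, and
`I_k^(1) := 2/(k+1)`. -/
noncomputable def fareyI (k n : ℕ) : ℝ :=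
  if n = 1 then 2 / ((k : ℝ) + 1) else fareyR k (2 * n) - fareyR k (2 * n - 2)

/-- Total length of even intervals at level `k`. -/
noncomputable def fareyIe (k : ℕ) : ℝ :=
  ∑ i ∈ Finset.Icc 1 (2 ^ (k - 2)), fareyI k (2 * i)

/-- Total length of odd intervals at level `k`. -/
noncomputable def fareyIo (k : ℕ) : ℝ :=
  ∑ i ∈ Finset.Icc 1 (2 ^ (k - 2)), fareyI k (2 * i - 1)

/-- `S_k`: the sum of inverse squares of the new denominators at level `k`. -/
noncomputable def fareyS (k : ℕ) : ℝ :=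
  ∑ n ∈ Finset.Icc 1 (2 ^ (k - 1)), 1 / (fareyDen k (2 * n) : ℝ) ^ 2

theorem fareyNum_succ_even (k n : ℕ) :
    fareyNum (k + 1) (2 * n) = fareyNum k n + fareyNum k (n + 1) := by
  simp [fareyNum]

theorem fareyNum_succ_odd (k n : ℕ) : fareyNum (k + 1) (2 * n + 1) = fareyNum k (n + 1) := by
  rw [fareyNum, if_pos (by omega), show (2 * n + 1 + 1) / 2 = n + 1 by omega]

theorem fareyDen_succ_even (k n : ℕ) :
    fareyDen (k + 1) (2 * n) = fareyDen k n + fareyDen k (n + 1) := by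
  simp [fareyDen]

theorem fareyDen_succ_odd (k n : ℕ) : fareyDen (k + 1) (2 * n + 1) = fareyDen k (n + 1) := by
  rw [fareyDen, if_pos (by omega), show (2 * n + 1 + 1) / 2 = n + 1 by omega]

theorem fareyDen_pos (k n : ℕ) : 0 < fareyDen k n := by
  induction k generalizing n with
  | zero => simp [fareyDen]
  | succ k ih =>
    rw [fareyDen]
    split_ifs
    · exact ih _
    · exact Nat.add_pos_left (ih _) _

/-- Consecutive Farey fractions are unimodular. -/
theorem fareyNum_mul_fareyDen_eq (k n : ℕ) (h1 : 1 ≤ n) (h2 : n ≤ 2 ^ k) :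
    fareyNum k (n + 1) * fareyDen k n = fareyNum k n * fareyDen k (n + 1) + 1 := by
  induction k generalizing n with
  | zero =>
    obtain rfl : n = 1 := by simpa using le_antisymm h2 h1
    simp [fareyNum, fareyDen]
  | succ k ih =>
    rw [pow_succ] at h2
    obtain ⟨m, rfl | rfl⟩ := n.even_or_odd'
    · have := ih m (by omega) (by omega)
      rw [fareyNum_succ_odd, fareyDen_succ_odd, fareyNum_succ_even, fareyDen_succ_even]
      linarith
    · have := ih (m + 1) (by omega) (by omega)
      rw [show 2 * m + 1 + 1 = 2 * (m + 1) by ring, fareyNum_succ_odd, fareyDen_succ_odd,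
        fareyNum_succ_even, fareyDen_succ_even]
      linarith

/-- Length of the even interval `I_{k+2}^(2n)` in terms of denominators at level `k`. -/
theorem farey_even_interval_length (k n : ℕ) (h1 : 1 ≤ n) (h2 : n ≤ 2 ^ k) :
    fareyI (k + 2) (2 * n) =
      3 / (((fareyDen k n : ℝ) + 2 * (fareyDen k (n + 1) : ℝ)) *
        (2 * (fareyDen k n : ℝ) + (fareyDen k (n + 1) : ℝ))) := by
  obtain ⟨m, rfl⟩ : ∃ m, n = m + 1 := ⟨n - 1, by omega⟩
  have hdet : (fareyNum k (m + 1 + 1) : ℝ) * fareyDen k (m + 1) =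
      fareyNum k (m + 1) * fareyDen k (m + 1 + 1) + 1 := by
    exact_mod_cast fareyNum_mul_fareyDen_eq k (m + 1) h1 h2
  have ha : (0 : ℝ) < fareyDen k (m + 1) := by exact_mod_cast fareyDen_pos k (m + 1)
  have hb : (0 : ℝ) < fareyDen k (m + 1 + 1) := by exact_mod_cast fareyDen_pos k (m + 1 + 1)
  rw [fareyI, if_neg (by omega),
    show 2 * (2 * (m + 1)) - 2 = 2 * (2 * m + 1) by omega, fareyR, fareyR]
  simp only [fareyNum_succ_even (k + 1), fareyDen_succ_even (k + 1), fareyNum_succ_odd,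
    fareyDen_succ_odd, show 2 * m + 1 + 1 = 2 * (m + 1) by ring, fareyNum_succ_even k,
    fareyDen_succ_even k]
  push_cast
  generalize (fareyNum k (m + 1) : ℝ) = p at *
  generalize (fareyNum k (m + 1 + 1) : ℝ) = q at *
  generalize (fareyDen k (m + 1) : ℝ) = a at *
  generalize (fareyDen k (m + 1 + 1) : ℝ) = b at *
  rw [div_sub_div _ _ (by positivity) (by positivity),
    div_eq_div_iff (by positivity) (by positivity)]
  linear_combination 3 * ((a + 2 * b) * (2 * a + b)) * hdet
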